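/- Low-Rank Plus Block Diagonal approximation: Let A ∈ ℝ^{n×n}. Let B₁ ∪ B₂ ∪ … ∪ B_b = [n] be a partition of [n], and let W ∈ {0,1}^{n×n} be defined by W_{i,j} = 0 if i and j lie in the same block B_l for some l, and W_{i,j} = 1 otherwise. Fix ε ∈ (0,1] and a rank parameter k ≥ 1, and let k' ≥ 32k/ε. Then every matrix L of rank at most k' satisfying ‖A ∘ W − L‖_F² ≤ (min over matrices L̂ of rank at most k' of ‖A ∘ W − L̂‖_F²) + ε·‖A ∘ W‖_F² also satisfies ‖(A − L) ∘ W‖_F² ≤ OPT + 2ε·‖A ∘ W‖_F², where OPT = min over matrices L̂ of rank at most k of ‖(A − L̂) ∘ W‖_F². -/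

import Mathlib

open Matrix BigOperators

/-- Squared Frobenius norm. -/
noncomputable def frob2 {n p : ℕ} (M : Matrix (Fin n) (Fin p) ℝ) : ℝ :=
  ∑ i, ∑ j, (M i j) ^ 2

theorem Matrix.rank_add_le_rank_add_rank {m n : Type*} [Fintype m] [Fintype n]
    (A B : Matrix m n ℝ) : (A + B).rank ≤ A.rank + B.rank := by
  unfold Matrix.rank
  rw [Matrix.mulVecLin_add]
  exact (Submodule.finrank_mono (LinearMap.range_add_le _ _)).trans
    (Submodule.finrank_add_le_finrank_add_finrank _ _)

theorem Matrix.rank_sum_le_card_mul {ι m n : Type*} [Fintype m] [Fintype n] {k : ℕ} (s : Finset ι)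
    (f : ι → Matrix m n ℝ) (hf : ∀ c ∈ s, (f c).rank ≤ k) : (∑ c ∈ s, f c).rank ≤ s.card * k := by
  classical
  induction s using Finset.induction_on with
  | empty => simp
  | insert a s ha ih =>
    rw [Finset.sum_insert ha, Finset.card_insert_of_notMem ha]
    have h₁ := hf a (Finset.mem_insert_self a s)
    have h₂ := ih fun c hc => hf c (Finset.mem_insert_of_mem hc)
    have h₃ := Matrix.rank_add_le_rank_add_rank (f a) (∑ c ∈ s, f c)
    linarith

/-- Zeroing the entries of `M` whose row and column have the same colour multiplies the rank by at
most the number of colours. -/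
theorem Matrix.rank_of_ite_eq_zero_le {n κ : Type*} [Fintype n] [DecidableEq n] [Fintype κ]
    [DecidableEq κ] (M : Matrix n n ℝ) (g : n → κ) :
    (Matrix.of fun i j => if g i = g j then 0 else M i j).rank ≤ Fintype.card κ * M.rank := by
  have h : (Matrix.of fun i j => if g i = g j then 0 else M i j) =
      ∑ c : κ, Matrix.diagonal (fun i => if g i = c then (1 : ℝ) else 0) * M *
        Matrix.diagonal (fun j => if g j = c then (0 : ℝ) else 1) := by
    ext i j
    simp only [Matrix.sum_apply, Matrix.mul_diagonal, Matrix.diagonal_mul, Matrix.of_apply]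
    rw [Finset.sum_eq_single_of_mem (g i) (Finset.mem_univ _) fun c _ hc => by simp [hc.symm]]
    simp [eq_comm]
  rw [h]
  exact Matrix.rank_sum_le_card_mul Finset.univ _ fun c _ =>
    (Matrix.rank_mul_le_left _ _).trans (Matrix.rank_mul_le_right _ _)

/-- A uniformly random map to `ZMod m` makes two distinct points collide with probability `1 / m`. -/
theorem sum_collision_eq {α : Type*} [Fintype α] [DecidableEq α] {m : ℕ} [NeZero m] {u v : α}
    (huv : u ≠ v) :
    (m : ℝ) * ∑ h : α → ZMod m, (if h u = h v then (1 : ℝ) else 0) =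
      Fintype.card (α → ZMod m) := by
  have key (c : ZMod m) : ∑ h : α → ZMod m, (if h u = h v then (1 : ℝ) else 0) =
      ∑ h : α → ZMod m, (if c = h v - h u then (1 : ℝ) else 0) := by
    rw [← Equiv.sum_comp (Equiv.addRight (Pi.single u c : α → ZMod m))]
    refine Finset.sum_congr rfl fun h _ => ?_
    simp [huv.symm, eq_sub_iff_add_eq, add_comm]
  calc (m : ℝ) * ∑ h : α → ZMod m, (if h u = h v then (1 : ℝ) else 0)
      = ∑ _c : ZMod m, ∑ h : α → ZMod m, (if h u = h v then (1 : ℝ) else 0) := by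
        simp [ZMod.card]
    _ = ∑ c : ZMod m, ∑ h : α → ZMod m, (if c = h v - h u then (1 : ℝ) else 0) :=
        Finset.sum_congr rfl fun c _ => key c
    _ = Fintype.card (α → ZMod m) := by
        rw [Finset.sum_comm]
        simp

/-- Some map to `ZMod m` has total collision weight at most `1 / m` of the total weight. -/
theorem exists_collision_weight_le {n α : Type*} [Fintype n] [Fintype α] [DecidableEq α] {m : ℕ}
    [NeZero m] (blk : n → α) (w : n → n → ℝ) (hw : ∀ i j, blk i = blk j → w i j = 0) :
    ∃ h : α → ZMod m,
      (m : ℝ) * ∑ i, ∑ j, (if h (blk i) = h (blk j) then w i j else 0) ≤ ∑ i, ∑ j, w i j := by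
  suffices H : ∑ h : α → ZMod m,
      (m : ℝ) * ∑ i, ∑ j, (if h (blk i) = h (blk j) then w i j else 0) ≤
      ∑ _h : α → ZMod m, ∑ i, ∑ j, w i j by
    obtain ⟨h, -, hh⟩ := Finset.exists_le_of_sum_le Finset.univ_nonempty H
    exact ⟨h, hh⟩
  apply le_of_eq
  calc _ = ∑ i, ∑ j, w i j * ((m : ℝ) *
        ∑ h : α → ZMod m, (if h (blk i) = h (blk j) then (1 : ℝ) else 0)) := by
        rw [← Finset.mul_sum, Finset.sum_comm]
        simp_rw [Finset.mul_sum]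
        refine Finset.sum_congr rfl fun i _ => ?_
        rw [Finset.sum_comm]
        refine Finset.sum_congr rfl fun j _ => Finset.sum_congr rfl fun h _ => ?_
        split_ifs <;> ring
    _ = ∑ i, ∑ j, w i j * Fintype.card (α → ZMod m) := by
        refine Finset.sum_congr rfl fun i _ => Finset.sum_congr rfl fun j _ => ?_
        by_cases hij : blk i = blk j
        · simp [hw i j hij]
        · rw [sum_collision_eq hij]
    _ = _ := by
        rw [Finset.sum_const, nsmul_eq_mul, Finset.card_univ, Finset.mul_sum]
        simp_rw [Finset.mul_sum, mul_comm]

theorem frob2_nonneg {n p : ℕ} (M : Matrix (Fin n) (Fin p) ℝ) : 0 ≤ frob2 M :=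
  Finset.sum_nonneg fun _ _ => Finset.sum_nonneg fun _ _ => sq_nonneg _

theorem exists_rank_le_frob2_le {n b m : ℕ} [NeZero m] (A W M : Matrix (Fin n) (Fin n) ℝ)
    (blk : Fin n → Fin b) (hW : ∀ i j, W i j = if blk i = blk j then 0 else 1) :
    ∃ N : Matrix (Fin n) (Fin n) ℝ, N.rank ≤ m * M.rank ∧
      frob2 (Matrix.hadamard A W - N) ≤
        frob2 (Matrix.hadamard (A - M) W) + (1 / m) * frob2 (Matrix.hadamard A W) := by
  obtain ⟨h, hh⟩ := exists_collision_weight_le (m := m) blk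
    (fun i j => (Matrix.hadamard A W i j) ^ 2) (fun i j hij => by simp [hW, hij])
  refine ⟨Matrix.of fun i j => if h (blk i) = h (blk j) then 0 else M i j, ?_, ?_⟩
  · simpa [ZMod.card] using Matrix.rank_of_ite_eq_zero_le M (fun i => h (blk i))
  · have hm : (0 : ℝ) < m := by exact_mod_cast NeZero.pos m
    calc _ ≤ frob2 (Matrix.hadamard (A - M) W) + ∑ i, ∑ j,
          (if h (blk i) = h (blk j) then (Matrix.hadamard A W i j) ^ 2 else 0) := by
          unfold frob2
          simp_rw [← Finset.sum_add_distrib]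
          refine Finset.sum_le_sum fun i _ => Finset.sum_le_sum fun j _ => ?_
          by_cases hij : blk i = blk j
          · simp [hW, hij]
          · by_cases hhij : h (blk i) = h (blk j) <;> simp [hW, hij, hhij, sq_nonneg]
      _ ≤ _ := by
          gcongr
          rw [one_div, le_inv_mul_iff₀ hm]
          exact hh

/-- Low-Rank Plus Block Diagonal approximation. The partition
`B₁ ∪ … ∪ B_b = [n]` is encoded by a surjective block-assignment map `blk : Fin n → Fin b`. -/
theorem stmt4
    {n b k k' : ℕ} (hk : 1 ≤ k)
    (A : Matrix (Fin n) (Fin n) ℝ)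
    (blk : Fin n → Fin b) (hblk : Function.Surjective blk)
    (W : Matrix (Fin n) (Fin n) ℝ)
    (hW : ∀ i j, W i j = if blk i = blk j then 0 else 1)
    (ε : ℝ) (hε : 0 < ε) (hε1 : ε ≤ 1)
    (hk' : 32 * (k : ℝ) / ε ≤ (k' : ℝ))
    (L : Matrix (Fin n) (Fin n) ℝ) (hL_rank : L.rank ≤ k')
    (hL_near : frob2 (Matrix.hadamard A W - L) ≤
      sInf {x : ℝ | ∃ M : Matrix (Fin n) (Fin n) ℝ, M.rank ≤ k' ∧
        x = frob2 (Matrix.hadamard A W - M)} + ε * frob2 (Matrix.hadamard A W)) :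
    frob2 (Matrix.hadamard (A - L) W) ≤
      sInf {x : ℝ | ∃ M : Matrix (Fin n) (Fin n) ℝ, M.rank ≤ k ∧
        x = frob2 (Matrix.hadamard (A - M) W)} + 2 * ε * frob2 (Matrix.hadamard A W) := by
  have hpos : 0 < 1 / ε := by positivity
  have hm : 0 < ⌈1 / ε⌉₊ := Nat.ceil_pos.mpr hpos
  have : NeZero ⌈1 / ε⌉₊ := ⟨hm.ne'⟩
  have hinv : 1 / (⌈1 / ε⌉₊ : ℝ) ≤ ε := by
    rw [one_div_le (by exact_mod_cast hm) hε]
    exact Nat.le_ceil _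
  have hmk : ⌈1 / ε⌉₊ * k ≤ k' := by
    have h₁ : (⌈1 / ε⌉₊ : ℝ) < 1 / ε + 1 := Nat.ceil_lt_add_one hpos.le
    have h₂ : 1 ≤ 1 / ε := (one_le_div hε).mpr hε1
    have h₃ : (⌈1 / ε⌉₊ : ℝ) * k ≤ (32 * (1 / ε)) * k := by
      gcongr
      linarith
    have h₄ : (32 * (1 / ε)) * k = 32 * (k : ℝ) / ε := by ring
    exact_mod_cast h₃.trans (h₄.le.trans hk')
  have hmask : frob2 (Matrix.hadamard (A - L) W) ≤ frob2 (Matrix.hadamard A W - L) := by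
    refine Finset.sum_le_sum fun i _ => Finset.sum_le_sum fun j _ => ?_
    by_cases hij : blk i = blk j <;> simp [hW, hij, sq_nonneg]
  suffices H : sInf {x : ℝ | ∃ M : Matrix (Fin n) (Fin n) ℝ, M.rank ≤ k' ∧
        x = frob2 (Matrix.hadamard A W - M)} - ε * frob2 (Matrix.hadamard A W) ≤
      sInf {x : ℝ | ∃ M : Matrix (Fin n) (Fin n) ℝ, M.rank ≤ k ∧
        x = frob2 (Matrix.hadamard (A - M) W)} by
    linarith
  refine le_csInf ⟨_, 0, by simp, rfl⟩ ?_
  rintro x ⟨M, hM, rfl⟩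
  obtain ⟨N, hN, hle⟩ := exists_rank_le_frob2_le (m := ⌈1 / ε⌉₊) A W M blk hW
  have hbdd : BddBelow {x : ℝ | ∃ M : Matrix (Fin n) (Fin n) ℝ, M.rank ≤ k' ∧
      x = frob2 (Matrix.hadamard A W - M)} :=
    ⟨0, by rintro x ⟨M, -, rfl⟩; exact frob2_nonneg _⟩
  have hinf := csInf_le hbdd ⟨N, hN.trans ((Nat.mul_le_mul_left _ hM).trans hmk), rfl⟩
  have hε' := mul_le_mul_of_nonneg_right hinv (frob2_nonneg (Matrix.hadamard A W))
  linarith
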